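/- arXiv:1801.04561 — 5 statements merged into one kernel-verified Lean document; each statement's English description precedes it below -/
import Mathlib

section
/- Let G be a finite group, F a finite field, V a faithful finite-dimensional FG-module, and X a set of representatives for the conjugacy classes of elements of prime order in G. If n is a positive integer for which |V|^n > Σ_{g∈X} |g^G| · |C_V(g)|^n, then there exist vectors v₁, …, vₙ ∈ V such that the only element of G fixing every vᵢ is the identity; that is, G has a base of size at most n on V. -/
/-- Every nontrivial element of a finite group has a power of prime order. -/
theorem exists_pow_orderOf_prime {G : Type*} [Group G] [Finite G] {g : G} (hg : g ≠ 1) :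
    ∃ k : ℕ, (orderOf (g ^ k)).Prime := by
  have hne : orderOf g ≠ 1 := by rwa [Ne, orderOf_eq_one_iff]
  refine ⟨orderOf g / (orderOf g).minFac, ?_⟩
  rw [orderOf_pow_orderOf_div (orderOf_pos g).ne' (Nat.minFac_dvd _)]
  exact Nat.minFac_prime hne

/-- Conjugate elements have fixed-point subspaces of the same size. -/
theorem Representation.natCard_fixedPoints_eq_of_isConj {F G V : Type*} [Group G] [CommSemiring F]
    [AddCommMonoid V] [Module F V] (ρ : Representation F G V) {g h : G} (hgh : IsConj g h) :
    Nat.card {v : V // ρ g v = v} = Nat.card {v : V // ρ h v = v} := by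
  obtain ⟨c, rfl⟩ := isConj_iff.mp hgh
  refine Nat.card_congr
    { toFun := fun v => ⟨ρ c v, ?_⟩
      invFun := fun v => ⟨ρ c⁻¹ v, ?_⟩
      left_inv := fun v => by simp
      right_inv := fun v => by simp }
  · simp [v.2]
  · have hv := congrArg (ρ c⁻¹) v.2
    simpa using hv

/-- The number of `ι`-tuples of fixed points of `g` is a power of the number of fixed points. -/
theorem Representation.natCard_fixed_tuples {F G V ι : Type*} [Group G] [CommSemiring F]
    [AddCommMonoid V] [Module F V] [Finite ι] (ρ : Representation F G V) (g : G) :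
    Nat.card {v : ι → V // ∀ i, ρ g (v i) = v i} = Nat.card {v : V // ρ g v = v} ^ Nat.card ι := by
  rw [← Nat.card_fun]
  exact Nat.card_congr (Equiv.subtypePiEquivPi (p := fun _ v => ρ g v = v))

/-- Let `G` be a finite group, `F` a finite field, `V` a faithful
finite-dimensional `FG`-module, and `X` a set of representatives for the conjugacy classes of
elements of prime order in `G`.  If `n` is a positive integer for which
`|V|^n > ∑_{g ∈ X} |g^G| · |C_V(g)|^n`, then there exist vectors `v₁, …, vₙ ∈ V` such that the
only element of `G` fixing every `vᵢ` is the identity; that is, `G` has a base of size at most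
`n` on `V`. -/
theorem base_of_size_n_of_fixed_point_bound {G F V : Type*} [Group G] [Fintype G]
    [Field F] [Fintype F] [AddCommGroup V] [Module F V] [FiniteDimensional F V] [Fintype V]
    (ρ : Representation F G V) (hfaith : Function.Injective ρ)
    (X : Finset G)
    (hXprime : ∀ g ∈ X, (orderOf g).Prime)
    (hXrep : ∀ g : G, (orderOf g).Prime → ∃! x, x ∈ X ∧ IsConj x g)
    (n : ℕ) (hn : 0 < n)
    (h : ∑ g ∈ X, Nat.card {h : G // IsConj g h} * Nat.card {v : V // ρ g v = v} ^ n <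
      Fintype.card V ^ n) :
    ∃ v : Fin n → V, ∀ g : G, (∀ i, ρ g (v i) = v i) → g = 1 := by
  classical
  by_contra! hbase
  refine h.not_ge ?_
  have hcover : (Finset.univ : Finset (Fin n → V)) ⊆
      X.biUnion fun x => (Finset.univ.filter fun g => IsConj x g).biUnion fun g =>
        Finset.univ.filter fun v : Fin n → V => ∀ i, ρ g (v i) = v i := by
    intro v _
    obtain ⟨g, hgv, hg⟩ := hbase v
    obtain ⟨k, hk⟩ := exists_pow_orderOf_prime hg
    obtain ⟨x, ⟨hxX, hxk⟩, -⟩ := hXrep _ hk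
    simp only [Finset.mem_biUnion, Finset.mem_filter, Finset.mem_univ, true_and]
    refine ⟨x, hxX, g ^ k, hxk, fun i => ?_⟩
    rw [map_pow, Module.End.pow_apply]
    exact Function.IsFixedPt.iterate (hgv i) k
  calc Fintype.card V ^ n = (Finset.univ : Finset (Fin n → V)).card := by simp
    _ ≤ _ := Finset.card_le_card hcover
    _ ≤ _ := Finset.card_biUnion_le
    _ ≤ _ := Finset.sum_le_sum fun x _ => ?_
  refine (Finset.card_biUnion_le_card_mul _ _ (Nat.card {v : V // ρ x v = v} ^ n) ?_).trans_eq ?_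
  · intro g hg
    rw [ρ.natCard_fixedPoints_eq_of_isConj (Finset.mem_filter.mp hg).2]
    simpa [Fintype.card_subtype] using (ρ.natCard_fixed_tuples (ι := Fin n) g).le
  · rw [Nat.card_eq_fintype_card (α := {g : G // IsConj x g}), Fintype.card_subtype]
end

section
/- Let Ḡ be a group with a nonabelian simple normal subgroup T whose centraliser in Ḡ is trivial (so Ḡ is almost simple with socle T), and let x ∈ Ḡ be a nontrivial element. Then the subgroup of Ḡ generated by the T-conjugates x^t (t ∈ T) of x equals the subgroup ⟨T, x⟩ generated by T together with x. -/
/-- The subgroup generated by the `T`-conjugates of `x` is normalised by `T`. -/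
theorem conj_mem_closure_conjugates {G : Type*} [Group G] (T : Subgroup G) (x : G)
    {s k : G} (hs : s ∈ T)
    (hk : k ∈ Subgroup.closure {y : G | ∃ t ∈ T, y = t⁻¹ * x * t}) :
    s * k * s⁻¹ ∈ Subgroup.closure {y : G | ∃ t ∈ T, y = t⁻¹ * x * t} := by
  induction hk using Subgroup.closure_induction with
  | mem y hy =>
    obtain ⟨t, ht, rfl⟩ := hy
    exact Subgroup.subset_closure ⟨t * s⁻¹, T.mul_mem ht (T.inv_mem hs), by group⟩
  | one => simp
  | mul a b _ _ ha hb => simpa [mul_assoc] using mul_mem ha hb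
  | inv a _ ha => simpa [mul_assoc] using inv_mem ha


/-- Let `Ḡ` be a group with a nonabelian simple normal subgroup `T` whose
centraliser in `Ḡ` is trivial (so `Ḡ` is almost simple with socle `T`), and let `x ∈ Ḡ` be a
nontrivial element.  Then the subgroup of `Ḡ` generated by the `T`-conjugates `x^t` (`t ∈ T`)
of `x` equals the subgroup `⟨T, x⟩` generated by `T` together with `x`. -/
theorem closure_conjugates_eq_sup {G : Type*} [Group G]
    (T : Subgroup G) [T.Normal]
    (hsimple : IsSimpleGroup T) (hnonab : ¬ ∀ a b : T, a * b = b * a)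
    (hcent : Subgroup.centralizer (T : Set G) = ⊥)
    (x : G) (hx : x ≠ 1) :
    Subgroup.closure {y : G | ∃ t ∈ T, y = t⁻¹ * x * t} =
      T ⊔ Subgroup.closure {x} := by
  set K := Subgroup.closure {y : G | ∃ t ∈ T, y = t⁻¹ * x * t} with hK
  have hxK : x ∈ K := Subgroup.subset_closure ⟨1, T.one_mem, by simp⟩
  have hnormal : (K.subgroupOf T).Normal :=
    ⟨fun _ hk s ↦ conj_mem_closure_conjugates T x s.2 hk⟩
  have hTK : T ≤ K := by
    rcases hnormal.eq_bot_or_eq_top with hbot | htop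
    · refine absurd ?_ hx
      rw [← Subgroup.mem_bot, ← hcent, Subgroup.mem_centralizer_iff]
      intro t ht
      have hcommT : x⁻¹ * (t⁻¹ * x * t) ∈ T := by
        have h := T.mul_mem (Subgroup.Normal.conj_mem ‹_› _ (T.inv_mem ht) x⁻¹) ht
        simpa [mul_assoc] using h
      have hcommK : x⁻¹ * (t⁻¹ * x * t) ∈ K :=
        K.mul_mem (K.inv_mem hxK) (Subgroup.subset_closure ⟨t, ht, rfl⟩)
      have hcomm : x⁻¹ * (t⁻¹ * x * t) = 1 :=
        Subgroup.disjoint_def.mp (Subgroup.subgroupOf_eq_bot.mp hbot) hcommK hcommT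
      have hconj : t⁻¹ * (x * t) = x := by
        rw [← mul_assoc]
        exact (inv_mul_eq_one.mp hcomm).symm
      exact (inv_mul_eq_iff_eq_mul.mp hconj).symm
    · exact Subgroup.subgroupOf_eq_top.mp htop
  apply le_antisymm
  · rw [hK, Subgroup.closure_le]
    rintro _ ⟨t, ht, rfl⟩
    have htS : t ∈ T ⊔ Subgroup.closure {x} := Subgroup.mem_sup_left ht
    have hxS : x ∈ T ⊔ Subgroup.closure {x} :=
      Subgroup.mem_sup_right (Subgroup.mem_closure_singleton_self x)
    exact mul_mem (mul_mem (inv_mem htS) hxS) htS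
  · exact sup_le hTK ((Subgroup.closure_le K).mpr (Set.singleton_subset_iff.mpr hxK))
end

section
/- Let G be a finite group with centre Z = Z(G), and let T̂ be a normal subgroup of G containing Z such that T̂/Z is a nonabelian simple group. Let F be a field and V a faithful irreducible FG-module of dimension d. Let g ∈ G \ Z, let r be a positive integer, and suppose t₁, …, t_r ∈ G are such that the images of the conjugates g^{t₁}, …, g^{t_r} in G/Z generate a subgroup of G/Z containing T̂/Z. Then d ≤ r · (d − dim_F C_V(g)); equivalently, dim_F C_V(g) ≤ d − d/r. -/
open scoped commutatorElement

/-- The subgroup of elements fixing a given vector of a representation. -/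
def Representation.vectorStabilizer {G F V : Type*} [Group G] [Field F] [AddCommGroup V]
    [Module F V] (ρ : Representation F G V) (v : V) : Subgroup G where
  carrier := {x | ρ x v = v}
  one_mem' := by simp
  mul_mem' {a b} ha hb := by
    simp only [Set.mem_ofPred_eq] at ha hb ⊢
    rw [map_mul, Module.End.mul_apply, hb, ha]
  inv_mem' {a} ha := by
    simp only [Set.mem_ofPred_eq] at ha ⊢
    conv_lhs => rw [← ha]
    rw [← Module.End.mul_apply, ← map_mul, inv_mul_cancel, map_one, Module.End.one_apply]

theorem Representation.mem_vectorStabilizer {G F V : Type*} [Group G] [Field F] [AddCommGroup V]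
    [Module F V] (ρ : Representation F G V) (v : V) (x : G) :
    x ∈ ρ.vectorStabilizer v ↔ ρ x v = v := Iff.rfl

/-- The subspace of vectors fixed by every element of a subgroup. -/
def Representation.fixedSubmodule {G F V : Type*} [Group G] [Field F] [AddCommGroup V]
    [Module F V] (ρ : Representation F G V) (N : Subgroup G) : Submodule F V where
  carrier := {v | ∀ n ∈ N, ρ n v = v}
  zero_mem' n _ := map_zero _
  add_mem' {a b} ha hb n hn := by rw [map_add, ha n hn, hb n hn]
  smul_mem' c a ha n hn := by rw [map_smul, ha n hn]

theorem Representation.mem_fixedSubmodule {G F V : Type*} [Group G] [Field F] [AddCommGroup V]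
    [Module F V] (ρ : Representation F G V) (N : Subgroup G) (v : V) :
    v ∈ ρ.fixedSubmodule N ↔ ∀ n ∈ N, ρ n v = v := Iff.rfl

theorem Representation.apply_mem_fixedSubmodule {G F V : Type*} [Group G] [Field F]
    [AddCommGroup V] [Module F V] (ρ : Representation F G V) (N : Subgroup G) [hN : N.Normal]
    (x : G) {v : V} (hv : v ∈ ρ.fixedSubmodule N) : ρ x v ∈ ρ.fixedSubmodule N := by
  intro n hn
  have h := hv (x⁻¹ * n * x) (by simpa using hN.conj_mem n hn x⁻¹)
  conv_rhs => rw [← h]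
  simp only [← Module.End.mul_apply, ← map_mul]
  congr 2
  group

/-- If the image of `T` modulo the centre lies in that of `S`, then `S` contains `⁅T, T⁆`. -/
theorem Subgroup.commutator_le_of_map_center_le {G : Type*} [Group G] (T S : Subgroup G)
    (h : T.map (QuotientGroup.mk' (Subgroup.center G)) ≤
      S.map (QuotientGroup.mk' (Subgroup.center G))) : ⁅T, T⁆ ≤ S := by
  have key : ∀ a ∈ T, ∃ s ∈ S, ∃ z ∈ Subgroup.center G, a = s * z := by
    intro a ha
    obtain ⟨s, hs, hsa⟩ := h (Subgroup.mem_map_of_mem _ ha)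
    exact ⟨s, hs, s⁻¹ * a, QuotientGroup.eq.mp hsa, by group⟩
  rw [Subgroup.commutator_le]
  intro a ha b hb
  obtain ⟨s, hs, z, hz, rfl⟩ := key a ha
  obtain ⟨u, hu, w, hw, rfl⟩ := key b hb
  have hz' := Subgroup.mem_center_iff.mp hz
  have hw' := Subgroup.mem_center_iff.mp hw
  have : ⁅s * z, u * w⁆ = ⁅s, u⁆ := by
    rw [commutatorElement_def, commutatorElement_def, mul_inv_rev, mul_inv_rev]
    calc s * z * (u * w) * (z⁻¹ * s⁻¹) * (w⁻¹ * u⁻¹)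
        = s * (z * (u * w)) * z⁻¹ * s⁻¹ * w⁻¹ * u⁻¹ := by group
      _ = s * u * (w * s⁻¹) * w⁻¹ * u⁻¹ := by rw [← hz']; group
      _ = s * u * s⁻¹ * u⁻¹ := by rw [← hw']; group
  rw [this, commutatorElement_def]
  exact S.mul_mem (S.mul_mem (S.mul_mem hs hu) (S.inv_mem hs)) (S.inv_mem hu)


/-- Let `G` be a finite group with centre `Z = Z(G)`, and let `T̂` be a
normal subgroup of `G` containing `Z` such that `T̂/Z` is a nonabelian simple group.  Let `F`
be a field and `V` a faithful irreducible `FG`-module of dimension `d`.  Let `g ∈ G \ Z`, let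
`r` be a positive integer, and suppose `t₁, …, t_r ∈ G` are such that the images of the
conjugates `g^{t₁}, …, g^{t_r}` in `G/Z` generate a subgroup of `G/Z` containing `T̂/Z`.
Then `d ≤ r · (d − dim_F C_V(g))`. -/
theorem finrank_le_mul_codim_fixed_space {G F V : Type*} [Group G] [Fintype G]
    [Field F] [AddCommGroup V] [Module F V] [FiniteDimensional F V] [Nontrivial V]
    (T : Subgroup G) [T.Normal] (hZT : Subgroup.center G ≤ T)
    (hsimple : IsSimpleGroup (T.map (QuotientGroup.mk' (Subgroup.center G))))
    (hnonab : ¬ ∀ a b : (T.map (QuotientGroup.mk' (Subgroup.center G))), a * b = b * a)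
    (ρ : Representation F G V) (hfaith : Function.Injective ρ)
    (hirr : ∀ W : Submodule F V, (∀ g : G, ∀ v ∈ W, ρ g v ∈ W) → W = ⊥ ∨ W = ⊤)
    (g : G) (hg : g ∉ Subgroup.center G)
    (r : ℕ) (hr : 0 < r) (t : Fin r → G)
    (hgen : T.map (QuotientGroup.mk' (Subgroup.center G)) ≤
      Subgroup.closure
        (Set.range fun i => QuotientGroup.mk' (Subgroup.center G) ((t i)⁻¹ * g * t i))) :
    Module.finrank F V ≤
      r * (Module.finrank F V - Module.finrank F (LinearMap.ker (ρ g - LinearMap.id))) := by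
  classical
  have hfix : ρ.fixedSubmodule ⁅T, T⁆ = ⊥ := by
    refine (hirr _ fun x v hv => ρ.apply_mem_fixedSubmodule _ x hv).resolve_right fun htop => ?_
    refine hnonab ?_
    rintro ⟨_, a, ha, rfl⟩ ⟨_, b, hb, rfl⟩
    have hab : ⁅a, b⁆ = 1 := hfaith <| by
      ext v
      have hv : v ∈ ρ.fixedSubmodule ⁅T, T⁆ := htop ▸ Submodule.mem_top
      rw [map_one, Module.End.one_apply]
      exact hv _ (Subgroup.commutator_mem_commutator ha hb)
    rw [commutatorElement_eq_one_iff_mul_comm] at hab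
    ext1
    change QuotientGroup.mk' _ a * QuotientGroup.mk' _ b =
      QuotientGroup.mk' _ b * QuotientGroup.mk' _ a
    rw [← map_mul, ← map_mul, hab]
  let L : V →ₗ[F] (Fin r → LinearMap.range (ρ g - LinearMap.id)) :=
    LinearMap.pi fun i => (ρ g - LinearMap.id).rangeRestrict ∘ₗ ρ (t i)
  have hL : Function.Injective L := by
    rw [← LinearMap.ker_eq_bot, eq_bot_iff]
    intro v hv
    rw [← hfix, ρ.mem_fixedSubmodule]
    suffices h : ⁅T, T⁆ ≤ ρ.vectorStabilizer v from fun n hn => h hn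
    refine T.commutator_le_of_map_center_le _ (hgen.trans ?_)
    rw [Subgroup.closure_le]
    rintro _ ⟨i, rfl⟩
    refine Subgroup.mem_map_of_mem _ ?_
    have h0 : ρ g (ρ (t i) v) - ρ (t i) v = 0 :=
      congrArg Subtype.val (congrFun (LinearMap.mem_ker.mp hv) i)
    rw [ρ.mem_vectorStabilizer, mul_assoc, map_mul, map_mul, Module.End.mul_apply,
      Module.End.mul_apply, sub_eq_zero.mp h0, ← Module.End.mul_apply, ← map_mul,
      inv_mul_cancel, map_one, Module.End.one_apply]
  have hle := LinearMap.finrank_le_finrank_of_injective hL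
  rw [Module.finrank_pi_fintype, Finset.sum_const, Finset.card_univ, Fintype.card_fin,
    smul_eq_mul] at hle
  rwa [← LinearMap.finrank_range_add_finrank_ker (ρ g - LinearMap.id), Nat.add_sub_cancel,
    LinearMap.finrank_range_add_finrank_ker]
end

section
/- Let G be a finite group such that G/Z(G) is almost simple with socle T (that is, T is a nonabelian simple normal subgroup of G/Z(G) with trivial centraliser in G/Z(G)). Let q be a prime power and V a faithful irreducible F_qG-module of dimension d over F_q. Let X be a set of representatives for the conjugacy classes of noncentral elements of prime order in G. If G has no regular orbit on V, then the real-number inequality q^d ≤ Σ_{g∈X} |g^G| · q^{d − d/r(g)} holds, where for each noncentral g ∈ G, r(g) denotes the minimal number of T-conjugates of the coset Z(G)g that generate the subgroup ⟨T, Z(G)g⟩ of G/Z(G). -/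
namespace Representation

open scoped commutatorElement

variable {G F V : Type*} [Group G] [Field F] [AddCommGroup V] [Module F V]

/-- The subspace of vectors fixed by `ρ g`. -/
def fixedSpace (ρ : Representation F G V) (g : G) : Submodule F V :=
  LinearMap.eqLocus (ρ g) LinearMap.id

theorem mem_fixedSpace {ρ : Representation F G V} {g : G} {v : V} :
    v ∈ ρ.fixedSpace g ↔ ρ g v = v :=
  Iff.rfl

theorem eq_one_of_forall_apply_eq {ρ : Representation F G V} (hfaith : Function.Injective ρ)
    {g : G} (h : ∀ v, ρ g v = v) : g = 1 :=
  hfaith <| by rw [map_one]; exact LinearMap.ext h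

theorem apply_mul_inv_mul_eq_iff (ρ : Representation F G V) (a g : G) (v : V) :
    ρ (a⁻¹ * g * a) v = v ↔ ρ g (ρ a v) = ρ a v := by
  rw [map_mul, map_mul, Module.End.mul_apply, Module.End.mul_apply]
  constructor
  · intro h
    simpa using congrArg (ρ a) h
  · intro h
    rw [h, ← Module.End.mul_apply, ← map_mul, inv_mul_cancel, map_one, Module.End.one_apply]

/-- Conjugate elements have equally many fixed vectors. -/
theorem card_fixedSpace_eq_of_isConj (ρ : Representation F G V) {g h : G} (hgh : IsConj g h) :
    Nat.card (ρ.fixedSpace h) = Nat.card (ρ.fixedSpace g) := by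
  obtain ⟨c, rfl⟩ := isConj_iff.1 hgh
  have e (v : V) : ρ (c * g * c⁻¹) v = v ↔ ρ g (ρ c⁻¹ v) = ρ c⁻¹ v := by
    simpa using ρ.apply_mul_inv_mul_eq_iff c⁻¹ g v
  refine Nat.card_congr
    { toFun := fun v => ⟨ρ c⁻¹ v, (e v).1 v.2⟩
      invFun := fun v => ⟨ρ c v, (e _).2 ?_⟩
      left_inv := fun v => by simp
      right_inv := fun v => by simp }
  simpa using mem_fixedSpace.1 v.2

/-- A nontrivial central element fixes no nonzero vector of a faithful irreducible module. -/
theorem eq_zero_of_mem_center {ρ : Representation F G V} (hfaith : Function.Injective ρ)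
    (hirr : ∀ W : Submodule F V, (∀ g : G, ∀ v ∈ W, ρ g v ∈ W) → W = ⊥ ∨ W = ⊤)
    {z : G} (hz : z ∈ Subgroup.center G) (hz1 : z ≠ 1) {v : V} (hv : ρ z v = v) : v = 0 := by
  rcases hirr (ρ.fixedSpace z) (fun g w hw => by
    rw [mem_fixedSpace] at hw ⊢
    rw [← Module.End.mul_apply, ← map_mul, ← Subgroup.mem_center_iff.1 hz g, map_mul,
      Module.End.mul_apply, hw]) with h | h
  · exact (Submodule.mem_bot F).1 (h ▸ mem_fixedSpace.2 hv)
  · exact absurd (eq_one_of_forall_apply_eq hfaith fun w =>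
      mem_fixedSpace.1 (h ▸ Submodule.mem_top)) hz1

/-- If a point stabiliser of a faithful irreducible module covers a nonabelian normal subgroup
of the central quotient, then the point is zero. -/
theorem eq_zero_of_le_map_stabilizer {ρ : Representation F G V} (hfaith : Function.Injective ρ)
    (hirr : ∀ W : Submodule F V, (∀ g : G, ∀ v ∈ W, ρ g v ∈ W) → W = ⊥ ∨ W = ⊤)
    (T : Subgroup (G ⧸ Subgroup.center G)) [T.Normal] (hnonab : ¬ ∀ a b : T, a * b = b * a)
    {v : V} {K : Subgroup G} (hK : ∀ k ∈ K, ρ k v = v)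
    (hT : T ≤ K.map (QuotientGroup.mk' (Subgroup.center G))) : v = 0 := by
  let N := T.comap (QuotientGroup.mk' (Subgroup.center G))
  let W : Submodule F V := ⨅ x : N, ⨅ y : N, ρ.fixedSpace ⁅(x : G), (y : G)⁆
  have memW (w : V) : w ∈ W ↔ ∀ x ∈ N, ∀ y ∈ N, ρ ⁅x, y⁆ w = w := by
    simp only [W, Submodule.mem_iInf, mem_fixedSpace, Subtype.forall]
  have hvW : v ∈ W := by
    have lift (x : G) (hx : x ∈ N) : ∃ k ∈ K, ∃ z ∈ Subgroup.center G, x = k * z := by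
      obtain ⟨k, hk, hkx⟩ := hT hx
      exact ⟨k, hk, k⁻¹ * x, QuotientGroup.eq.1 hkx, by group⟩
    refine (memW v).2 fun x hx y hy => ?_
    obtain ⟨k, hk, z, hz, rfl⟩ := lift x hx
    obtain ⟨l, hl, t, ht, rfl⟩ := lift y hy
    have hcomm : ⁅k * z, l * t⁆ = ⁅k, l⁆ := by
      have hz' := Subgroup.mem_center_iff.1 hz
      have ht' := Subgroup.mem_center_iff.1 ht
      calc ⁅k * z, l * t⁆ = k * (z * (l * t)) * z⁻¹ * k⁻¹ * t⁻¹ * l⁻¹ := by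
            simp only [commutatorElement_def, mul_inv_rev, mul_assoc]
        _ = k * l * (t * k⁻¹) * t⁻¹ * l⁻¹ := by rw [← hz' (l * t)]; group
        _ = ⁅k, l⁆ := by rw [← ht' k⁻¹, commutatorElement_def]; group
    rw [hcomm]
    exact hK _ (Subgroup.commutator_le_self K (Subgroup.commutator_mem_commutator hk hl))
  have hWinv : ∀ g : G, ∀ w ∈ W, ρ g w ∈ W := fun g w hw => by
    rw [memW] at hw ⊢
    intro x hx y hy
    have hn : N.Normal := inferInstance
    have := hw _ (hn.conj_mem' x hx g) _ (hn.conj_mem' y hy g)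
    have e : ⁅g⁻¹ * x * g, g⁻¹ * y * g⁆ = g⁻¹ * ⁅x, y⁆ * g := by
      simp only [commutatorElement_def]; group
    rwa [e, apply_mul_inv_mul_eq_iff] at this
  rcases hirr W hWinv with h | h
  · exact (Submodule.mem_bot F).1 (h ▸ hvW)
  · refine absurd (fun a b => Subtype.ext ?_) hnonab
    obtain ⟨x, hx⟩ := QuotientGroup.mk'_surjective _ (a : G ⧸ Subgroup.center G)
    obtain ⟨y, hy⟩ := QuotientGroup.mk'_surjective _ (b : G ⧸ Subgroup.center G)
    have hxy : ⁅x, y⁆ = 1 := eq_one_of_forall_apply_eq hfaith fun w =>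
      (memW w).1 (h ▸ Submodule.mem_top)
        x (Subgroup.mem_comap.2 (hx ▸ a.2)) y (Subgroup.mem_comap.2 (hy ▸ b.2))
    rw [Subgroup.coe_mul, Subgroup.coe_mul, ← hx, ← hy, ← map_mul, ← map_mul,
      commutatorElement_eq_one_iff_mul_comm.1 hxy]

/-- If `n` conjugates of `Z(G)g` generate a subgroup containing the nonabelian normal subgroup
`T`, then the fixed space of `g` has codimension at least `dim V / n`. -/
theorem finrank_le_mul_finrank_quotient_fixedSpace [FiniteDimensional F V]
    {ρ : Representation F G V} (hfaith : Function.Injective ρ)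
    (hirr : ∀ W : Submodule F V, (∀ g : G, ∀ v ∈ W, ρ g v ∈ W) → W = ⊥ ∨ W = ⊤)
    (T : Subgroup (G ⧸ Subgroup.center G)) [T.Normal] (hnonab : ¬ ∀ a b : T, a * b = b * a)
    (g : G) {n : ℕ} (f : Fin n → G ⧸ Subgroup.center G)
    (hf : T ≤ Subgroup.closure (Set.range fun i => (f i)⁻¹ * (g : G ⧸ Subgroup.center G) * f i)) :
    Module.finrank F V ≤ n * Module.finrank F (V ⧸ ρ.fixedSpace g) := by
  choose a ha using fun i => QuotientGroup.mk'_surjective _ (f i)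
  let L : V →ₗ[F] Fin n → V ⧸ ρ.fixedSpace g :=
    LinearMap.pi fun i => (ρ.fixedSpace g).mkQ ∘ₗ ρ (a i)
  have hL : Function.Injective L := by
    refine (injective_iff_map_eq_zero L).2 fun v hv => ?_
    let K : Subgroup G := Subgroup.closure (Set.range fun i => (a i)⁻¹ * g * a i)
    refine eq_zero_of_le_map_stabilizer hfaith hirr T hnonab (K := K) (fun k hk => ?_)
      (hf.trans ?_)
    · induction hk using Subgroup.closure_induction with
      | mem x hx =>
        obtain ⟨i, rfl⟩ := hx
        have : (ρ.fixedSpace g).mkQ (ρ (a i) v) = 0 := congrFun hv i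
        rw [Submodule.mkQ_apply, Submodule.Quotient.mk_eq_zero, mem_fixedSpace] at this
        exact (apply_mul_inv_mul_eq_iff ρ _ _ _).2 this
      | one => simp
      | mul x y _ _ hx hy => rw [map_mul, Module.End.mul_apply, hy, hx]
      | inv x _ hx => simpa using (congrArg (ρ x⁻¹) hx).symm
    · rw [Subgroup.closure_le]
      rintro _ ⟨i, rfl⟩
      refine ⟨_, Subgroup.subset_closure ⟨i, rfl⟩, ?_⟩
      simp only [map_mul, map_inv, ha]
      rfl
  simpa [Module.finrank_pi_fintype] using LinearMap.finrank_le_finrank_of_injective hL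

/-- Every vector of a faithful irreducible module without regular orbits is fixed by a noncentral
element of prime order. -/
theorem exists_prime_order_notMem_center_apply_eq [Finite G] [Nontrivial V]
    {ρ : Representation F G V} (hfaith : Function.Injective ρ)
    (hirr : ∀ W : Submodule F V, (∀ g : G, ∀ v ∈ W, ρ g v ∈ W) → W = ⊥ ∨ W = ⊤)
    (hnoreg : ∀ v : V, ∃ g : G, g ≠ 1 ∧ ρ g v = v) (v : V) :
    ∃ g : G, (orderOf g).Prime ∧ g ∉ Subgroup.center G ∧ ρ g v = v := by
  wlog hv : v ≠ 0 generalizing v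
  · obtain ⟨w, hw⟩ := exists_ne (0 : V)
    obtain ⟨g, hg, hgc, -⟩ := this w hw
    exact ⟨g, hg, hgc, by rw [not_not.1 hv, map_zero]⟩
  obtain ⟨g, hg1, hgv⟩ := hnoreg v
  obtain ⟨p, hp, hpg⟩ := Nat.exists_prime_and_dvd (mt orderOf_eq_one_iff.1 hg1)
  have hord : orderOf (g ^ (orderOf g / p)) = p :=
    orderOf_pow_orderOf_div (orderOf_pos g).ne' hpg
  have hfix : ρ (g ^ (orderOf g / p)) v = v := by
    rw [map_pow, Module.End.pow_apply]
    exact Function.iterate_fixed hgv _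
  refine ⟨g ^ (orderOf g / p), hord.symm ▸ hp, fun hc => hv ?_, hfix⟩
  refine eq_zero_of_mem_center hfaith hirr hc (fun h1 => hp.one_lt.ne' ?_) hfix
  rw [← hord, h1, orderOf_one]

open scoped Classical in
/-- If every vector is fixed by a conjugate of some element of `X`, then counting fixed vectors
class by class bounds the size of the module. -/
theorem card_le_sum_card_conj_mul_card_fixedSpace [Finite G] [Finite V]
    (ρ : Representation F G V) (X : Finset G)
    (hX : ∀ v : V, ∃ x ∈ X, ∃ h, IsConj x h ∧ ρ h v = v) :
    Nat.card V ≤ ∑ x ∈ X, Nat.card {h : G // IsConj x h} * Nat.card (ρ.fixedSpace x) := by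
  have := Fintype.ofFinite G
  have := Fintype.ofFinite V
  let S (x : G) : Finset V :=
    (Finset.univ.filter (IsConj x)).biUnion fun h => Finset.univ.filter fun v => ρ h v = v
  have hcover : Finset.univ ⊆ X.biUnion S := fun v _ => by
    obtain ⟨x, hx, h, hxh, hv⟩ := hX v
    simp only [S, Finset.mem_biUnion, Finset.mem_filter, Finset.mem_univ, true_and]
    exact ⟨x, hx, h, hxh, hv⟩
  have hS (x : G) :
      (S x).card ≤ Nat.card {h : G // IsConj x h} * Nat.card (ρ.fixedSpace x) := by
    rw [Nat.card_eq_fintype_card (α := {h : G // IsConj x h}), Fintype.card_subtype]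
    refine Finset.card_biUnion_le_card_mul _ _ _ fun h hh => ?_
    rw [← ρ.card_fixedSpace_eq_of_isConj (Finset.mem_filter.1 hh).2, ← Fintype.card_subtype,
      ← Nat.card_eq_fintype_card]
    exact le_rfl
  rw [Nat.card_eq_fintype_card, ← Finset.card_univ]
  exact (Finset.card_le_card hcover).trans
    (Finset.card_biUnion_le.trans (Finset.sum_le_sum fun x _ => hS x))

end Representation


/-- Let `G` be a finite group such that `G/Z(G)` is almost simple with socle
`T`.  Let `q` be a prime power and `V` a faithful irreducible `𝔽_q G`-module of dimension `d`
over `𝔽_q`.  Let `X` be a set of representatives for the conjugacy classes of noncentral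
elements of prime order in `G`.  If `G` has no regular orbit on `V`, then the real-number
inequality `q^d ≤ ∑_{g ∈ X} |g^G| · q^{d − d/r(g)}` holds, where for each noncentral `g ∈ G`,
`r(g)` is the minimal number of `T`-conjugates of the coset `Z(G)g` generating the subgroup
`⟨T, Z(G)g⟩` of `G/Z(G)`. -/
theorem no_regular_orbit_real_inequality {G F V : Type*} [Group G] [Fintype G]
    [Field F] [Fintype F] [AddCommGroup V] [Module F V] [FiniteDimensional F V]
    [Fintype V] [Nontrivial V]
    (T : Subgroup (G ⧸ Subgroup.center G)) [T.Normal]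
    (hsimple : IsSimpleGroup T) (hnonab : ¬ ∀ a b : T, a * b = b * a)
    (hcent : Subgroup.centralizer (T : Set (G ⧸ Subgroup.center G)) = ⊥)
    (q : ℕ) (hq : Fintype.card F = q)
    (ρ : Representation F G V) (hfaith : Function.Injective ρ)
    (hirr : ∀ W : Submodule F V, (∀ g : G, ∀ v ∈ W, ρ g v ∈ W) → W = ⊥ ∨ W = ⊤)
    (d : ℕ) (hd : Module.finrank F V = d)
    (r : G → ℕ)
    (hr : ∀ g : G, g ∉ Subgroup.center G →
      r g = sInf {n : ℕ | ∃ f : Fin n → T,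
        Subgroup.closure (Set.range fun i =>
            ((f i : G ⧸ Subgroup.center G))⁻¹ * ((g : G) : G ⧸ Subgroup.center G) * (f i)) =
          T ⊔ Subgroup.closure {((g : G) : G ⧸ Subgroup.center G)}})
    (X : Finset G)
    (hX : ∀ g ∈ X, (orderOf g).Prime ∧ g ∉ Subgroup.center G)
    (hXrep : ∀ g : G, (orderOf g).Prime → g ∉ Subgroup.center G →
      ∃! x, x ∈ X ∧ IsConj x g)
    (hnoreg : ∀ v : V, ∃ g : G, g ≠ 1 ∧ ρ g v = v) :
    (q : ℝ) ^ d ≤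
      ∑ g ∈ X, (Nat.card {h : G // IsConj g h} : ℝ) *
        (q : ℝ) ^ ((d : ℝ) - (d : ℝ) / (r g : ℝ)) := by
  have hq1 : (1 : ℝ) ≤ q := by
    rw [← hq]
    exact_mod_cast Fintype.card_pos
  have hcard : (q : ℝ) ^ d = (Nat.card V : ℝ) := by
    rw [Module.natCard_eq_pow_finrank (K := F), Nat.card_eq_fintype_card, hq, hd, Nat.cast_pow]
  have hcover : ∀ v : V, ∃ x ∈ X, ∃ h, IsConj x h ∧ ρ h v = v := fun v => by
    obtain ⟨g, hg, hgc, hgv⟩ :=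
      Representation.exists_prime_order_notMem_center_apply_eq hfaith hirr hnoreg v
    obtain ⟨x, ⟨hx, hxg⟩, -⟩ := hXrep g hg hgc
    exact ⟨x, hx, g, hxg, hgv⟩
  have hle : (Nat.card V : ℝ) ≤ ∑ x ∈ X,
      (Nat.card {h : G // IsConj x h} : ℝ) * (Nat.card (ρ.fixedSpace x) : ℝ) := by
    exact_mod_cast ρ.card_le_sum_card_conj_mul_card_fixedSpace X hcover
  rw [hcard]
  refine hle.trans (Finset.sum_le_sum fun g hg => mul_le_mul_of_nonneg_left ?_ (Nat.cast_nonneg _))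
  rw [Module.natCard_eq_pow_finrank (K := F), Nat.card_eq_fintype_card, hq, Nat.cast_pow,
    ← Real.rpow_natCast]
  refine Real.rpow_le_rpow_of_exponent_le hq1 ?_
  have hsum := (ρ.fixedSpace g).finrank_quotient_add_finrank
  rw [hd] at hsum
  have hsum' : (Module.finrank F (V ⧸ ρ.fixedSpace g) : ℝ) +
      Module.finrank F (ρ.fixedSpace g) = d := by exact_mod_cast hsum
  rcases Nat.eq_zero_or_pos (r g) with h0 | hpos
  · rw [h0, Nat.cast_zero, div_zero, sub_zero, ← hsum']
    exact le_add_of_nonneg_left (Nat.cast_nonneg _)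
  · have hrg := hr g (hX g hg).2
    obtain ⟨f, hf⟩ := Nat.sInf_mem (Nat.nonempty_of_pos_sInf (hrg ▸ hpos))
    have hbound := Representation.finrank_le_mul_finrank_quotient_fixedSpace hfaith hirr T hnonab g
      (fun i => (f i : G ⧸ Subgroup.center G)) (le_sup_left.trans hf.ge)
    rw [← hrg, hd] at hbound
    have hdiv : (d : ℝ) / r g ≤ Module.finrank F (V ⧸ ρ.fixedSpace g) := by
      rw [div_le_iff₀' (by exact_mod_cast hpos)]
      exact_mod_cast hbound
    linarith
end

section
/- A finite group L is a covering group of some almost simple group if and only if Z(L) ≤ L' and L/Z(L) is almost simple. (Explicitly: if Z(L) ≤ L' and L/Z(L) is almost simple, then L is a covering group of L/Z(L); conversely, if L is a covering group of an almost simple group G by a subgroup M, then M = Z(L), so Z(L) ≤ L' and L/Z(L) ≅ G is almost simple.) -/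
/-- A group is almost simple if it has a nonabelian simple normal subgroup with trivial
centraliser. -/
def IsAlmostSimple (G : Type*) [Group G] : Prop :=
  ∃ T : Subgroup G, T.Normal ∧ IsSimpleGroup T ∧ (¬ ∀ a b : T, a * b = b * a) ∧
    Subgroup.centralizer (T : Set G) = ⊥

/-- A finite group `L` is a covering group of a group `G` if there is a surjection `L → G`
whose kernel `M` satisfies `M ≤ Z(L) ∩ L'` (so `M ≤ Z(L) ∩ L'` and `L/M ≅ G`). -/
def IsCoveringGroupOf (L : Type*) [Group L] (G : Type*) [Group G] : Prop :=
  ∃ φ : L →* G, Function.Surjective φ ∧ φ.ker ≤ Subgroup.center L ⊓ commutator L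

theorem IsAlmostSimple.of_mulEquiv {G H : Type*} [Group G] [Group H] (e : G ≃* H)
    (hG : IsAlmostSimple G) : IsAlmostSimple H := by
  obtain ⟨T, hT, hs, hnc, hc⟩ := hG
  let f : T ≃* T.map e.toMonoidHom := e.subgroupMap T
  refine ⟨T.map e.toMonoidHom, hT.map _ e.surjective, ?_, ?_, ?_⟩
  · have : Nontrivial (T.map e.toMonoidHom) := f.symm.toEquiv.nontrivial
    exact IsSimpleGroup.isSimpleGroup_of_surjective f.toMonoidHom f.surjective
  · intro h
    refine hnc fun a b => f.injective ?_
    rw [map_mul, map_mul, h]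
  · rw [Subgroup.eq_bot_iff_forall]
    intro x hx
    have hmem : e.symm x ∈ Subgroup.centralizer (T : Set G) := by
      rw [Subgroup.mem_centralizer_iff] at hx ⊢
      intro t ht
      apply e.injective
      simpa using hx (e t) ⟨t, ht, rfl⟩
    rw [hc, Subgroup.mem_bot] at hmem
    simpa using hmem

theorem IsAlmostSimple.center_eq_bot {G : Type*} [Group G] (hG : IsAlmostSimple G) :
    Subgroup.center G = ⊥ := by
  obtain ⟨T, -, -, -, hc⟩ := hG
  exact le_bot_iff.mp (hc ▸ Subgroup.center_le_centralizer (T : Set G))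

theorem MonoidHom.center_le_ker_of_surjective {L G : Type*} [Group L] [Group G] (φ : L →* G)
    (hφ : Function.Surjective φ) (hG : Subgroup.center G = ⊥) :
    Subgroup.center L ≤ φ.ker := by
  intro z hz
  have hmem : φ z ∈ Subgroup.center G := by
    rw [Subgroup.mem_center_iff] at hz ⊢
    intro g
    obtain ⟨l, rfl⟩ := hφ g
    rw [← map_mul, ← map_mul, hz]
  rwa [hG, Subgroup.mem_bot] at hmem

/-- A finite group `L` is a covering group of some almost simple group if
and only if `Z(L) ≤ L'` and `L/Z(L)` is almost simple. -/
theorem isCoveringGroupOf_almostSimple_iff {L : Type u} [Group L] [Fintype L] :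
    (∃ (G : Type u) (_ : Group G), IsCoveringGroupOf L G ∧ IsAlmostSimple G) ↔
    (Subgroup.center L ≤ commutator L ∧ IsAlmostSimple (L ⧸ Subgroup.center L)) := by
  constructor
  · rintro ⟨G, _, ⟨φ, hφ, hker⟩, hG⟩
    have hle := φ.center_le_ker_of_surjective hφ hG.center_eq_bot
    have heq : Subgroup.center L = φ.ker := le_antisymm hle (hker.trans inf_le_left)
    exact ⟨hle.trans (hker.trans inf_le_right), hG.of_mulEquiv
      ((QuotientGroup.quotientMulEquivOfEq heq).trans
        (QuotientGroup.quotientKerEquivOfSurjective φ hφ)).symm⟩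
  · rintro ⟨hle, hL⟩
    refine ⟨L ⧸ Subgroup.center L, inferInstance, ⟨QuotientGroup.mk' (Subgroup.center L),
      QuotientGroup.mk'_surjective _, ?_⟩, hL⟩
    rw [QuotientGroup.ker_mk']
    exact le_inf le_rfl hle
end
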